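/- Let F be a field and N a positive integer. An element g ∈ Sp_{2N}(F) lies in the double coset Q_N(F)·ε_r·Q_N(F) if and only if the lower-left N×N block of g has rank N−r. Consequently, Sp_{2N}(F) is the disjoint union of the double cosets Q_N(F)·ε_r·Q_N(F) for 0 ≤ r ≤ N, and the matrices ε_r (0 ≤ r ≤ N) form a complete and irredundant set of representatives for Q_N(F)\Sp_{2N}(F)/Q_N(F). -/

import Mathlib

open Matrix

/-- The `k × k` permutation matrix with `1`'s along the main anti-diagonal. -/
def wM (F : Type*) [Field F] (k : ℕ) : Matrix (Fin k) (Fin k) F :=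
  Matrix.of fun i j => if (i : ℕ) + (j : ℕ) + 1 = k then 1 else 0

/-- The `2k × 2k` matrix `J_k = ((0, w_k), (−w_k, 0))` defining the symplectic form. -/
def JM (F : Type*) [Field F] (k : ℕ) :
    Matrix (Fin k ⊕ Fin k) (Fin k ⊕ Fin k) F :=
  Matrix.fromBlocks 0 (wM F k) (-(wM F k)) 0

/-- The symplectic group `Sp_{2k}(F) = { g ∈ GL_{2k}(F) : ᵗg·J_k·g = J_k }`,
as a set of `2k × 2k` matrices (indexed by `Fin k ⊕ Fin k`). -/
def Sp (F : Type*) [Field F] (k : ℕ) :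
    Set (Matrix (Fin k ⊕ Fin k) (Fin k ⊕ Fin k) F) :=
  { g | IsUnit g ∧ gᵀ * JM F k * g = JM F k }

/-- The global (natural-number) index of a row/column index of a `2k × 2k` matrix. -/
def idx {k : ℕ} : Fin k ⊕ Fin k → ℕ
  | Sum.inl i => (i : ℕ)
  | Sum.inr i => k + (i : ℕ)

/-- The Weyl representative `ε_r = diag(I_r, ((0, I_{N−r}), (−I_{N−r}, 0)), I_r)`,
written entrywise in global coordinates. -/
def eps (F : Type*) [Field F] (N r : ℕ) :
    Matrix (Fin N ⊕ Fin N) (Fin N ⊕ Fin N) F :=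
  Matrix.of fun p q =>
    if idx p = idx q ∧ (idx q < r ∨ 2 * N - r ≤ idx q) then 1
    else if r ≤ idx p ∧ idx p < N ∧ idx q = idx p + (N - r) then 1
    else if N ≤ idx p ∧ idx p < 2 * N - r ∧ idx p = idx q + (N - r) then -1
    else 0

/-- The Siegel parabolic subgroup `Q_N(F)`. -/
def QN (F : Type*) [Field F] (N : ℕ) :
    Set (Matrix (Fin N ⊕ Fin N) (Fin N ⊕ Fin N) F) :=
  { g | g ∈ Sp F N ∧ Matrix.toBlocks₂₁ g = 0 }

namespace Matrix

variable {n R : Type*} [Fintype n] [DecidableEq n] [Field R]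

/-- Square matrices of equal rank over a field are equivalent. -/
theorem exists_isUnit_mul_mul_eq_of_rank_eq {A B : Matrix n n R} (h : A.rank = B.rank) :
    ∃ V U : Matrix n n R, IsUnit V ∧ IsUnit U ∧ V * A * U = B := by
  obtain ⟨V, U, e, hV, hU, hA⟩ := exists_rank_normal_form A
  obtain ⟨V', U', f, hV', hU', hB⟩ := exists_rank_normal_form B
  generalize A.rank = k at h e hA
  subst h
  refine ⟨V'⁻¹ * V.submatrix (f.trans e.symm) (Equiv.refl n),
    U.submatrix (Equiv.refl n) (f.trans e.symm) * U'⁻¹, ?_, ?_, ?_⟩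
  · exact ((isUnit_nonsing_inv_iff).2 hV').mul ((isUnit_submatrix_equiv _ _).2 hV)
  · exact ((isUnit_submatrix_equiv _ _).2 hU).mul ((isUnit_nonsing_inv_iff).2 hU')
  · have hσ : V.submatrix (f.trans e.symm) (Equiv.refl n) * A *
        U.submatrix (Equiv.refl n) (f.trans e.symm) = V' * B * U' := by
      calc _ = (V * A * U).submatrix (f.trans e.symm) (f.trans e.symm) := rfl
        _ = _ := by
          rw [hA, hB]
          ext i j
          simp
    calc _ = V'⁻¹ * (V.submatrix (f.trans e.symm) (Equiv.refl n) * A *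
        U.submatrix (Equiv.refl n) (f.trans e.symm)) * U'⁻¹ := by simp only [mul_assoc]
      _ = B := by
        rw [hσ, mul_assoc V', nonsing_inv_mul_cancel_left _ _ ((isUnit_iff_isUnit_det _).1 hV'),
          mul_nonsing_inv_cancel_right _ _ ((isUnit_iff_isUnit_det _).1 hU')]

/-- Every rank of a square matrix is attained by a symmetric idempotent matrix. -/
theorem exists_isSymm_isIdempotentElem_rank_eq (A : Matrix n n R) :
    ∃ E : Matrix n n R, E.IsSymm ∧ IsIdempotentElem E ∧ E.rank = A.rank := by
  obtain ⟨V, U, e, hV, hU, hA⟩ := exists_rank_normal_form A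
  refine ⟨V * A * U, ?_, ?_, ?_⟩
  · rw [hA, IsSymm, transpose_submatrix, fromBlocks_transpose]
    simp
  · rw [hA, IsIdempotentElem, submatrix_mul_equiv, fromBlocks_multiply]
    simp
  · rw [rank_mul_eq_left_of_isUnit_det _ _ ((isUnit_iff_isUnit_det _).1 hU),
      rank_mul_eq_right_of_isUnit_det _ _ ((isUnit_iff_isUnit_det _).1 hV)]

end Matrix

section Siegel

variable {F : Type*} [Field F] {N : ℕ}

theorem wM_transpose : (wM F N)ᵀ = wM F N := by
  ext i j
  simp [wM, add_comm (i : ℕ)]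

theorem wM_eq_submatrix : wM F N = (1 : Matrix (Fin N) (Fin N) F).submatrix Fin.revPerm id := by
  ext i j
  simp only [wM, of_apply, submatrix_apply, one_apply, id, Fin.revPerm_apply, Fin.ext_iff,
    Fin.val_rev]
  congr 1
  exact propext (by omega)

theorem wM_mul_apply (A : Matrix (Fin N) (Fin N) F) (i j : Fin N) :
    (wM F N * A) i j = A i.rev j := by
  simp [wM_eq_submatrix, mul_apply, one_apply]

theorem mul_wM_apply (A : Matrix (Fin N) (Fin N) F) (i j : Fin N) :
    (A * wM F N) i j = A i j.rev := by
  simp [wM_eq_submatrix, mul_apply, one_apply, Fin.rev_eq_iff]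

theorem wM_mul_wM : wM F N * wM F N = 1 := by
  ext i j
  rw [wM_mul_apply, wM_eq_submatrix]
  rw [submatrix_apply, Fin.revPerm_apply, Fin.rev_rev, id]

theorem wM_mul_wM_mul (A : Matrix (Fin N) (Fin N) F) : wM F N * (wM F N * A) = A := by
  rw [← mul_assoc, wM_mul_wM, one_mul]

theorem isUnit_wM : IsUnit (wM F N) :=
  IsUnit.of_mul_eq_one _ wM_mul_wM

theorem JM_mul_JM : JM F N * JM F N = -1 := by
  rw [JM, fromBlocks_multiply, ← fromBlocks_one, fromBlocks_neg]
  simp [wM_mul_wM]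

theorem isUnit_JM : IsUnit (JM F N) :=
  IsUnit.of_mul_eq_one (-JM F N) (by rw [mul_neg, JM_mul_JM, neg_neg])

theorem mem_Sp_iff {g : Matrix (Fin N ⊕ Fin N) (Fin N ⊕ Fin N) F} :
    g ∈ Sp F N ↔ gᵀ * JM F N * g = JM F N := by
  refine ⟨And.right, fun h => ⟨?_, h⟩⟩
  have hu : IsUnit (gᵀ * JM F N * g).det := by
    rw [h]
    exact (isUnit_iff_isUnit_det _).1 isUnit_JM
  rw [det_mul] at hu
  exact (isUnit_iff_isUnit_det _).2 (isUnit_of_mul_isUnit_right hu)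

theorem fromBlocks_mem_Sp_iff {A B C D : Matrix (Fin N) (Fin N) F} :
    fromBlocks A B C D ∈ Sp F N ↔
      Aᵀ * wM F N * C = Cᵀ * wM F N * A ∧ Bᵀ * wM F N * D = Dᵀ * wM F N * B ∧
        Aᵀ * wM F N * D - Cᵀ * wM F N * B = wM F N := by
  rw [mem_Sp_iff, JM, fromBlocks_transpose, fromBlocks_multiply, fromBlocks_multiply,
    fromBlocks_inj]
  simp only [mul_zero, mul_neg, zero_add, add_zero, neg_mul]
  refine ⟨fun ⟨h₁, h₂, h₃, h₄⟩ => ⟨?_, ?_, ?_⟩, fun ⟨h₁, h₂, h₃⟩ => ⟨?_, ?_, ?_, ?_⟩⟩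
  · rw [neg_add_eq_zero] at h₁
    exact h₁.symm
  · rw [neg_add_eq_zero] at h₄
    exact h₄.symm
  · rw [sub_eq_neg_add, h₂]
  · rw [h₁, neg_add_cancel]
  · rw [← sub_eq_neg_add, h₃]
  · conv_rhs => rw [← wM_transpose, ← h₃]
    simp only [transpose_sub, transpose_mul, transpose_transpose, wM_transpose, mul_assoc]
    abel
  · rw [h₂, neg_add_cancel]

theorem mul_mem_Sp {g h : Matrix (Fin N ⊕ Fin N) (Fin N ⊕ Fin N) F} (hg : g ∈ Sp F N)
    (hh : h ∈ Sp F N) : g * h ∈ Sp F N := by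
  rw [mem_Sp_iff] at *
  rw [transpose_mul]
  calc hᵀ * gᵀ * JM F N * (g * h) = hᵀ * (gᵀ * JM F N * g) * h := by simp only [mul_assoc]
    _ = JM F N := by rw [hg, hh]

theorem mul_mem_QN {g h : Matrix (Fin N ⊕ Fin N) (Fin N ⊕ Fin N) F} (hg : g ∈ QN F N)
    (hh : h ∈ QN F N) : g * h ∈ QN F N := by
  refine ⟨mul_mem_Sp hg.1 hh.1, ?_⟩
  rw [← fromBlocks_toBlocks g, ← fromBlocks_toBlocks h, fromBlocks_multiply,
    toBlocks_fromBlocks₂₁, hg.2, hh.2]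
  simp

theorem neg_JM_mul_transpose_mul_JM_mul {g : Matrix (Fin N ⊕ Fin N) (Fin N ⊕ Fin N) F}
    (hg : g ∈ Sp F N) : -(JM F N * gᵀ * JM F N) * g = 1 := by
  rw [neg_mul, mul_assoc, mul_assoc, ← mul_assoc gᵀ, hg.2, JM_mul_JM, neg_neg]

theorem exists_inv_mem_Sp {g : Matrix (Fin N ⊕ Fin N) (Fin N ⊕ Fin N) F} (hg : g ∈ Sp F N) :
    ∃ h ∈ Sp F N, h * g = 1 ∧ g * h = 1 := by
  have h := neg_JM_mul_transpose_mul_JM_mul hg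
  have h' := mul_eq_one_comm.1 h
  refine ⟨_, ?_, h, h'⟩
  set k := -(JM F N * gᵀ * JM F N)
  rw [mem_Sp_iff]
  calc kᵀ * JM F N * k = kᵀ * (gᵀ * JM F N * g) * k := by rw [hg.2]
    _ = (g * k)ᵀ * JM F N * (g * k) := by rw [transpose_mul]; simp only [mul_assoc]
    _ = JM F N := by simp [h']

theorem exists_inv_mem_QN {g : Matrix (Fin N ⊕ Fin N) (Fin N ⊕ Fin N) F} (hg : g ∈ QN F N) :
    ∃ h ∈ QN F N, h * g = 1 ∧ g * h = 1 := by
  obtain ⟨h, hh, hl, hr⟩ := exists_inv_mem_Sp hg.1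
  refine ⟨h, ⟨hh, ?_⟩, hl, hr⟩
  have hk : h = -(JM F N * gᵀ * JM F N) :=
    (left_inv_eq_right_inv (neg_JM_mul_transpose_mul_JM_mul hg.1) hr).symm
  rw [hk, ← fromBlocks_toBlocks g, hg.2, JM, fromBlocks_transpose, fromBlocks_multiply,
    fromBlocks_multiply, fromBlocks_neg, toBlocks_fromBlocks₂₁]
  simp

/-- Two matrices are in the same double coset of the Siegel parabolic subgroup. -/
def SiegelEquiv (g h : Matrix (Fin N ⊕ Fin N) (Fin N ⊕ Fin N) F) : Prop :=
  ∃ q₁ ∈ QN F N, ∃ q₂ ∈ QN F N, g = q₁ * h * q₂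

namespace SiegelEquiv

variable {g h k : Matrix (Fin N ⊕ Fin N) (Fin N ⊕ Fin N) F}

theorem symm (hgh : SiegelEquiv g h) : SiegelEquiv h g := by
  obtain ⟨q₁, hq₁, q₂, hq₂, rfl⟩ := hgh
  obtain ⟨p₁, hp₁, hpq₁, -⟩ := exists_inv_mem_QN hq₁
  obtain ⟨p₂, hp₂, -, hqp₂⟩ := exists_inv_mem_QN hq₂
  refine ⟨p₁, hp₁, p₂, hp₂, ?_⟩
  calc h = (p₁ * q₁) * h * (q₂ * p₂) := by rw [hpq₁, hqp₂, one_mul, mul_one]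
    _ = _ := by simp only [mul_assoc]

theorem trans (hgh : SiegelEquiv g h) (hhk : SiegelEquiv h k) : SiegelEquiv g k := by
  obtain ⟨q₁, hq₁, q₂, hq₂, rfl⟩ := hgh
  obtain ⟨p₁, hp₁, p₂, hp₂, rfl⟩ := hhk
  exact ⟨q₁ * p₁, mul_mem_QN hq₁ hp₁, p₂ * q₂, mul_mem_QN hp₂ hq₂, by simp only [mul_assoc]⟩

theorem rank_toBlocks₂₁_eq (hgh : SiegelEquiv g h) :
    (toBlocks₂₁ g).rank = (toBlocks₂₁ h).rank := by
  obtain ⟨q₁, hq₁, q₂, hq₂, rfl⟩ := hgh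
  have hdet {q : Matrix (Fin N ⊕ Fin N) (Fin N ⊕ Fin N) F} (hq : q ∈ QN F N) :
      IsUnit (toBlocks₁₁ q).det ∧ IsUnit (toBlocks₂₂ q).det := by
    have hu := (isUnit_iff_isUnit_det _).1 hq.1.1
    rwa [← fromBlocks_toBlocks q, hq.2, det_fromBlocks_zero₂₁, IsUnit.mul_iff] at hu
  have hmul : toBlocks₂₁ (q₁ * h * q₂) = toBlocks₂₂ q₁ * toBlocks₂₁ h * toBlocks₁₁ q₂ := by
    conv_lhs => rw [← fromBlocks_toBlocks q₁, ← fromBlocks_toBlocks q₂, ← fromBlocks_toBlocks h,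
      hq₁.2, hq₂.2, fromBlocks_multiply, fromBlocks_multiply, toBlocks_fromBlocks₂₁]
    simp
  rw [hmul, rank_mul_eq_left_of_isUnit_det _ _ (hdet hq₂).1,
    rank_mul_eq_right_of_isUnit_det _ _ (hdet hq₁).2]

end SiegelEquiv

/-- The Levi subgroup of the Siegel parabolic contains elements with arbitrary invertible
upper-left block. -/
theorem exists_levi_of_upper {U : Matrix (Fin N) (Fin N) F} (hU : IsUnit U) :
    ∃ D, fromBlocks U 0 0 D ∈ QN F N := by
  obtain ⟨V, hV⟩ := hU.exists_left_inv
  refine ⟨wM F N * Vᵀ * wM F N, fromBlocks_mem_Sp_iff.2 ⟨by simp, by simp, ?_⟩, by simp⟩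
  rw [transpose_zero, zero_mul, zero_mul, sub_zero, mul_assoc, mul_assoc, wM_mul_wM_mul,
    ← mul_assoc, ← transpose_mul, hV, transpose_one, one_mul]

/-- The Levi subgroup of the Siegel parabolic contains elements with arbitrary invertible
lower-right block. -/
theorem exists_levi_of_lower {V : Matrix (Fin N) (Fin N) F} (hV : IsUnit V) :
    ∃ A, fromBlocks A 0 0 V ∈ QN F N := by
  obtain ⟨U, hU⟩ := hV.exists_left_inv
  refine ⟨(wM F N * U * wM F N)ᵀ, fromBlocks_mem_Sp_iff.2 ⟨by simp, by simp, ?_⟩, by simp⟩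
  rw [transpose_zero, zero_mul, zero_mul, sub_zero, transpose_transpose, mul_assoc, mul_assoc,
    wM_mul_wM_mul, mul_assoc, hU, mul_one]

/-- The symplectic partial Weyl element attached to an idempotent `E`. -/
def partialWeyl (E : Matrix (Fin N) (Fin N) F) : Matrix (Fin N ⊕ Fin N) (Fin N ⊕ Fin N) F :=
  fromBlocks (1 - E) (E * wM F N) (-(wM F N * E)) (wM F N * (1 - E) * wM F N)

theorem partialWeyl_mem_Sp {E : Matrix (Fin N) (Fin N) F} (hE : E.IsSymm)
    (hE' : IsIdempotentElem E) : partialWeyl E ∈ Sp F N := by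
  have hE'' (A : Matrix (Fin N) (Fin N) F) : E * (E * A) = E * A := by rw [← mul_assoc, hE'.eq]
  rw [partialWeyl, fromBlocks_mem_Sp_iff]
  simp only [transpose_sub, transpose_mul, transpose_neg, transpose_one, wM_transpose, hE.eq,
    mul_assoc, wM_mul_wM_mul, wM_mul_wM, sub_mul, mul_sub, neg_mul, mul_neg, hE'.eq, hE'', one_mul,
    mul_one]
  exact ⟨by abel, trivial, by abel⟩

theorem siegelEquiv_partialWeyl_of_toBlocks₂₁_eq
    {g : Matrix (Fin N ⊕ Fin N) (Fin N ⊕ Fin N) F} {E : Matrix (Fin N) (Fin N) F}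
    (hg : g ∈ Sp F N) (hE : E.IsSymm) (hE' : IsIdempotentElem E)
    (hC : toBlocks₂₁ g = wM F N * E) :
    SiegelEquiv g (partialWeyl E)⁻¹ := by
  obtain ⟨A, B, C, D, rfl⟩ : ∃ A B C D, g = fromBlocks A B C D :=
    ⟨_, _, _, _, (fromBlocks_toBlocks g).symm⟩
  rw [toBlocks_fromBlocks₂₁] at hC
  subst hC
  have hA : Aᵀ * E = E * A := by
    have := (fromBlocks_mem_Sp_iff.1 hg).1
    simpa only [transpose_mul, hE.eq, wM_transpose, mul_assoc, wM_mul_wM_mul, wM_mul_wM, mul_one]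
      using this
  have hEAE : E * (A * E) = E * A := by
    rw [← mul_assoc, ← hA, mul_assoc, hE'.eq]
  have hu : fromBlocks 1 (-(E * A * wM F N)) 0 1 ∈ QN F N := by
    refine ⟨fromBlocks_mem_Sp_iff.2 ⟨by simp, ?_, by simp⟩, by simp⟩
    simp only [transpose_neg, transpose_mul, wM_transpose, hE.eq, hA, neg_mul, mul_neg, mul_assoc,
      transpose_one, one_mul, mul_one]
  obtain ⟨p, hp, hpu, -⟩ := exists_inv_mem_QN hu
  have hW := partialWeyl_mem_Sp hE hE'
  refine ⟨p, hp, partialWeyl E * (fromBlocks 1 (-(E * A * wM F N)) 0 1 * fromBlocks A B _ D),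
    ⟨mul_mem_Sp hW (mul_mem_Sp hu.1 hg), ?_⟩, ?_⟩
  swap
  · rw [mul_assoc, nonsing_inv_mul_cancel_left _ _ ((isUnit_iff_isUnit_det _).1 hW.1),
      ← mul_assoc, hpu, one_mul]
  rw [partialWeyl, fromBlocks_multiply, fromBlocks_multiply, toBlocks_fromBlocks₂₁]
  simp only [mul_assoc, wM_mul_wM_mul, neg_mul, mul_add, mul_neg, one_mul, zero_mul,
    zero_add, sub_mul, mul_sub, hE'.eq, hEAE]
  simp [← mul_assoc E E, hE'.eq]

theorem siegelEquiv_partialWeyl {g : Matrix (Fin N ⊕ Fin N) (Fin N ⊕ Fin N) F}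
    {E : Matrix (Fin N) (Fin N) F} (hg : g ∈ Sp F N) (hE : E.IsSymm) (hE' : IsIdempotentElem E)
    (hr : (toBlocks₂₁ g).rank = E.rank) :
    SiegelEquiv g (partialWeyl E)⁻¹ := by
  have hwE : (toBlocks₂₁ g).rank = (wM F N * E).rank := by
    rw [hr, rank_mul_eq_right_of_isUnit_det _ _ ((isUnit_iff_isUnit_det _).1 isUnit_wM)]
  obtain ⟨V, U, hV, hU, hVU⟩ := exists_isUnit_mul_mul_eq_of_rank_eq hwE
  obtain ⟨A, hA⟩ := exists_levi_of_lower hV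
  obtain ⟨D, hD⟩ := exists_levi_of_upper hU
  refine (SiegelEquiv.symm ⟨_, hA, _, hD, rfl⟩).trans
    (siegelEquiv_partialWeyl_of_toBlocks₂₁_eq (mul_mem_Sp (mul_mem_Sp hA.1 hg) hD.1) hE hE' ?_)
  rw [← hVU, ← fromBlocks_toBlocks g, fromBlocks_multiply, fromBlocks_multiply]
  simp

theorem siegelEquiv_iff_rank_eq {g h : Matrix (Fin N ⊕ Fin N) (Fin N ⊕ Fin N) F}
    (hg : g ∈ Sp F N) (hh : h ∈ Sp F N) :
    SiegelEquiv g h ↔ (toBlocks₂₁ g).rank = (toBlocks₂₁ h).rank := by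
  refine ⟨SiegelEquiv.rank_toBlocks₂₁_eq, fun hr => ?_⟩
  obtain ⟨E, hE, hE', hEr⟩ := exists_isSymm_isIdempotentElem_rank_eq (toBlocks₂₁ h)
  exact (siegelEquiv_partialWeyl hg hE hE' (hr.trans hEr.symm)).trans
    (siegelEquiv_partialWeyl hh hE hE' hEr.symm).symm

theorem eps_eq_fromBlocks {r : ℕ} (hr : r ≤ N) :
    eps F N r = fromBlocks (diagonal fun i : Fin N => if (i : ℕ) < r then 1 else 0)
      (of fun i j : Fin N => if (i : ℕ) = j + r then 1 else 0)
      (of fun i j : Fin N => if (j : ℕ) = i + r then -1 else 0)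
      (diagonal fun i : Fin N => if N - r ≤ (i : ℕ) then 1 else 0) := by
  ext (i | i) (j | j) <;> have hi := i.2 <;> have hj := j.2 <;>
    simp only [eps, idx, of_apply, fromBlocks_apply₁₁, fromBlocks_apply₁₂, fromBlocks_apply₂₁,
      fromBlocks_apply₂₂, diagonal_apply, Fin.ext_iff] <;> grind

theorem rank_toBlocks₂₁_eps {r : ℕ} (hr : r ≤ N) : (toBlocks₂₁ (eps F N r)).rank = N - r := by
  classical
  rcases hr.eq_or_lt with rfl | hlt
  · have : toBlocks₂₁ (eps F r r) = 0 := by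
      ext i j
      have := i.2
      have := j.2
      simp only [toBlocks₂₁, eps, idx, of_apply, Matrix.zero_apply]
      grind
    rw [this, rank_zero, Nat.sub_self]
  have : NeZero N := ⟨by omega⟩
  have hC : toBlocks₂₁ (eps F N r) = (diagonal fun i : Fin N => if (i : ℕ) < N - r then (-1 : F)
      else 0).submatrix (Equiv.refl _) (Equiv.addRight (⟨r, hlt⟩ : Fin N)).symm := by
    ext i j
    have hi := i.2
    have hj := j.2
    have hij : i = j + -(⟨r, hlt⟩ : Fin N) ↔ ((i : ℕ) + r) % N = j := by
      rw [← sub_eq_add_neg, eq_sub_iff_add_eq, Fin.ext_iff, Fin.val_add]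
    simp only [toBlocks₂₁, eps, idx, of_apply, submatrix_apply, diagonal_apply, Equiv.refl_apply,
      Equiv.addRight_symm_apply, hij]
    by_cases hir : (i : ℕ) < N - r
    · rw [Nat.mod_eq_of_lt (by omega)]
      grind
    · grind
  rw [hC, rank_submatrix, rank_diagonal]
  simp only [ne_eq, ite_eq_right_iff, neg_eq_zero, one_ne_zero, imp_false, not_not]
  rw [Fintype.card_subtype, Fin.card_filter_val_lt]
  omega

theorem eps_mem_Sp {r : ℕ} (hr : r ≤ N) : eps F N r ∈ Sp F N := by
  rw [eps_eq_fromBlocks hr, fromBlocks_mem_Sp_iff, diagonal_transpose, diagonal_transpose]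
  refine ⟨?_, ?_, ?_⟩ <;> ext i j <;>
    have hi := i.2 <;> have hj := j.2
  · simp only [mul_assoc, diagonal_mul, wM_mul_apply, of_apply, Fin.val_rev]
    simp only [← mul_assoc, mul_diagonal, mul_wM_apply, of_apply, Fin.val_rev, transpose_apply]
    grind
  · simp only [mul_assoc, diagonal_mul, wM_mul_apply, of_apply, Fin.val_rev]
    simp only [← mul_assoc, mul_diagonal, mul_wM_apply, of_apply, Fin.val_rev, transpose_apply]
    grind
  · rw [Matrix.sub_apply, mul_diagonal, diagonal_mul, mul_apply]
    simp only [mul_wM_apply, of_apply, Fin.val_rev, transpose_apply]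
    simp only [wM, of_apply]
    by_cases hir : r ≤ i
    · rw [Finset.sum_eq_single (⟨i - r, by omega⟩ : Fin N).rev]
      · simp only [Fin.val_rev]
        grind
      · intro b _ hb
        have hb' : (b : ℕ) ≠ N - (i - r + 1) := by simpa [Fin.ext_iff] using hb
        grind
      · simp
    · rw [Finset.sum_eq_zero]
      · grind
      · grind

end Siegel

/-- Bruhat decomposition of `Sp_{2N}(F)` with respect to the Siegel parabolic:
`g ∈ Q_N(F)·ε_r·Q_N(F)` iff the lower-left `N × N` block of `g` has rank `N − r`;
the `ε_r`, `0 ≤ r ≤ N`, form a complete irredundant set of representatives of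
`Q_N(F)\Sp_{2N}(F)/Q_N(F)`. -/
theorem mem_QepsQ_iff_rank_and_complete_representatives (F : Type*) [Field F]
    (N : ℕ) (hN : 0 < N) :
    (∀ g ∈ Sp F N, ∀ r : ℕ, r ≤ N →
      ((∃ q₁ ∈ QN F N, ∃ q₂ ∈ QN F N, g = q₁ * eps F N r * q₂) ↔
        (Matrix.toBlocks₂₁ g).rank = N - r)) ∧
    (∀ g ∈ Sp F N, ∃! r : ℕ, r ≤ N ∧
      ∃ q₁ ∈ QN F N, ∃ q₂ ∈ QN F N, g = q₁ * eps F N r * q₂) := by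
  have key : ∀ g ∈ Sp F N, ∀ r : ℕ, r ≤ N →
      ((∃ q₁ ∈ QN F N, ∃ q₂ ∈ QN F N, g = q₁ * eps F N r * q₂) ↔
        (Matrix.toBlocks₂₁ g).rank = N - r) := fun g hg r hr => by
    rw [← rank_toBlocks₂₁_eps (F := F) hr]
    exact siegelEquiv_iff_rank_eq hg (eps_mem_Sp hr)
  refine ⟨key, fun g hg => ?_⟩
  have hle := (toBlocks₂₁ g).rank_le_width
  refine ⟨N - (toBlocks₂₁ g).rank, ⟨Nat.sub_le _ _, (key g hg _ (Nat.sub_le _ _)).2 (by omega)⟩,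
    fun r ⟨hr, h⟩ => ?_⟩
  have := (key g hg r hr).1 h
  omega
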